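/- Let 0 < μ < ν. There exists a constant C > 0, depending only on μ and ν, such that for all a > 0, b > 0 and t ≥ 0: | e^{−ν a t − μ b t} − e^{−ν b t − μ a t} | ≤ C e^{−(μ/2)(a+b) t} · |a − b| / (a + b). -/

import Mathlib

theorem heat_aux (μ ν : ℝ) (hμ : 0 < μ) (hμν : μ < ν) (a b t : ℝ) (ha : 0 < a) (hb : 0 < b)
    (ht : 0 ≤ t) (hab : a ≤ b) :
    |Real.exp (-(ν * a * t) - μ * b * t) - Real.exp (-(ν * b * t) - μ * a * t)| ≤
      (2 * (ν - μ) / μ) * Real.exp (-(μ / 2) * (a + b) * t) * (|a - b| / (a + b)) := by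
  have hd : 0 ≤ (ν - μ) * (b - a) * t :=
    mul_nonneg (mul_nonneg (by linarith) (by linarith)) ht
  have hc : 0 ≤ (ν - μ) * a * t :=
    mul_nonneg (mul_nonneg (by linarith) ha.le) ht
  set x := -(ν * a * t) - μ * b * t with hx
  set y := -(ν * b * t) - μ * a * t with hy
  set s := μ / 2 * (a + b) * t with hs
  have hxy : x - y = (ν - μ) * (b - a) * t := by rw [hx, hy]; ring
  have hyx : y ≤ x := by linarith
  have e1 : -(μ / 2) * (a + b) * t = -s := by rw [hs]; ring
  rw [e1, abs_of_nonneg (sub_nonneg.2 (Real.exp_le_exp.2 hyx)), abs_of_nonpos (by linarith)]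
  have h1 : Real.exp x - Real.exp y ≤ Real.exp x * (x - y) := by
    have h := Real.add_one_le_exp (y - x)
    have h2 : Real.exp y = Real.exp x * Real.exp (y - x) := by
      rw [← Real.exp_add]; congr 1; ring
    have := mul_le_mul_of_nonneg_left h (Real.exp_pos x).le
    rw [h2]; linarith
  have h2 : Real.exp x ≤ Real.exp (-s) * Real.exp (-s) := by
    rw [← Real.exp_add]
    apply Real.exp_le_exp.2
    rw [hx, hs]; linarith
  have h3 : Real.exp (-s) * s ≤ 1 := by
    have h := Real.add_one_le_exp s
    have h4 : Real.exp (-s) * Real.exp s = 1 := by rw [← Real.exp_add]; simp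
    have := mul_le_mul_of_nonneg_left h (Real.exp_pos (-s)).le
    linarith [Real.exp_pos (-s)]
  have hK : 0 ≤ (2 * (ν - μ) / μ) * Real.exp (-s) * (-(a - b) / (a + b)) :=
    mul_nonneg (mul_nonneg (div_nonneg (by linarith) hμ.le) (Real.exp_pos _).le)
      (div_nonneg (by linarith) (by linarith))
  calc Real.exp x - Real.exp y ≤ Real.exp x * (x - y) := h1
    _ ≤ (Real.exp (-s) * Real.exp (-s)) * (x - y) :=
        mul_le_mul_of_nonneg_right h2 (by linarith)
    _ = ((2 * (ν - μ) / μ) * Real.exp (-s) * (-(a - b) / (a + b))) * (Real.exp (-s) * s) := by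
        have : a + b ≠ 0 := by positivity
        rw [hxy]
        generalize Real.exp (-s) = E
        rw [hs]
        field_simp
        ring
    _ ≤ _ := mul_le_of_le_one_right hK h3

/-- **Difference of heat multipliers with distinct diffusivities.** For `0 < μ < ν` there is
`C > 0` (depending only on `μ, ν`) such that for all `a, b > 0` and `t ≥ 0`,
`|e^{−νat−μbt} − e^{−νbt−μat}| ≤ C e^{−(μ/2)(a+b)t} |a−b|/(a+b)`. -/
theorem heat_multiplier_difference_estimate (μ ν : ℝ) (hμ : 0 < μ) (hμν : μ < ν) :
    ∃ C : ℝ, 0 < C ∧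
      ∀ a b t : ℝ, 0 < a → 0 < b → 0 ≤ t →
        |Real.exp (-(ν * a * t) - μ * b * t) - Real.exp (-(ν * b * t) - μ * a * t)| ≤
          C * Real.exp (-(μ / 2) * (a + b) * t) * (|a - b| / (a + b)) := by
  refine ⟨2 * (ν - μ) / μ, div_pos (by linarith) hμ, fun a b t ha hb ht => ?_⟩
  rcases le_total a b with h | h
  · exact heat_aux μ ν hμ hμν a b t ha hb ht h
  · have := heat_aux μ ν hμ hμν b a t hb ha ht h
    rwa [abs_sub_comm, abs_sub_comm b a, add_comm b a] at this
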